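/- arXiv:2010.11914 — 4 statements merged into one kernel-verified Lean document; each statement's English description precedes it below -/
import Mathlib

section
/- Let N be a finite set and G ⊆ A_N a gaussoid. Suppose that for every diagonal matrix J indexed by N with all diagonal entries in {+1, −1} and every rational ε > 0, there exists a principally regular symmetric matrix Γ with rational entries such that CIS(Γ) = G and |Γ_{ab} − J_{ab}| < ε for all a, b ∈ N. Then for every hyperoctahedral image H of G — that is, H = {(π(i)π(j) | π((Z∖{i,j}) ⊕ K)) : (ij|K) ∈ G} for some Z ⊆ N and some permutation π of N — and every rational ε > 0, there exists a symmetric positive-definite matrix Σ with rational entries such that CIS(Σ) = H and |Σ_{ab} − I_{ab}| < ε for all a, b ∈ N, where I is the identity matrix. In particular every hyperoctahedral image of G is positively realizable over ℚ. -/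
open scoped symmDiff

abbrev CIStmt (N : Type*) := Sym2 N × Finset N

def CIStmt.proper {N : Type*} (s : CIStmt N) : Prop :=
  ¬ s.1.IsDiag ∧ ∀ i ∈ s.1, i ∉ s.2

variable {N : Type*} [DecidableEq N]

def pminor {R : Type*} [CommRing R] (M : Matrix N N R) (S : Finset N) : R :=
  (M.submatrix (fun a : S => (a : N)) (fun a : S => (a : N))).det

def apminor {R : Type*} [CommRing R] (M : Matrix N N R) (i j : N) (K : Finset N) : R :=
  (Matrix.of fun a b : Unit ⊕ ↥K =>
      M (Sum.elim (fun _ => i) (fun k => (k : N)) a)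
        (Sum.elim (fun _ => j) (fun k => (k : N)) b)).det

def PrinReg {R : Type*} [CommRing R] (M : Matrix N N R) : Prop :=
  ∀ S : Finset N, pminor M S ≠ 0

def PosDefMinors {R : Type*} [Field R] [LinearOrder R] [IsStrictOrderedRing R] (M : Matrix N N R) : Prop :=
  ∀ S : Finset N, 0 < pminor M S

def CIS {R : Type*} [CommRing R] (M : Matrix N N R) : Set (CIStmt N) :=
  {s | s.proper ∧ ∀ i j : N, s.1 = s(i, j) → apminor M i j s.2 = 0}

def IsGaussoid (G : Set (CIStmt N)) : Prop :=
  (∀ s ∈ G, s.proper) ∧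
  ∀ i j k : N, ∀ L : Finset N,
    i ≠ j → i ≠ k → j ≠ k → i ∉ L → j ∉ L → k ∉ L →
      (((s(i,j), L) ∈ G ∧ (s(i,k), insert j L) ∈ G) ↔
        ((s(i,k), L) ∈ G ∧ (s(i,j), insert k L) ∈ G)) ∧
      (((s(i,j), insert k L) ∈ G ∧ (s(i,k), insert j L) ∈ G) ↔
        ((s(i,j), L) ∈ G ∧ (s(i,k), L) ∈ G)) ∧
      (((s(i,j), L) ∈ G ∧ (s(i,j), insert k L) ∈ G) →
        ((s(i,k), L) ∈ G ∨ (s(j,k), L) ∈ G))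


open Matrix Filter Topology

def ZCond {N : Type*} [Fintype N] (M : Matrix N N ℚ) (i j : N) (K : Finset N) : Prop :=
  ∃ x : N → ℚ, x ≠ 0 ∧ (∀ a, a ∉ K → a ≠ j → x a = 0) ∧
    ∀ a, (a ∈ K ∨ a = i) → (M *ᵥ x) a = 0

lemma sum_supp {N : Type*} [Fintype N] [DecidableEq N] (K : Finset N) (j : N) (hj : j ∉ K)
    (f : N → ℚ) (hf : ∀ a, a ∉ K → a ≠ j → f a = 0) :
    ∑ a, f a = f j + ∑ k : K, f k := by
  rw [Finset.sum_coe_sort K f, ← Finset.sum_insert hj]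
  symm
  apply Finset.sum_subset (Finset.subset_univ _)
  intro a _ ha
  rw [Finset.mem_insert, not_or] at ha
  exact hf a ha.2 ha.1

lemma apminor_iff {N : Type*} [Fintype N] [DecidableEq N] (M : Matrix N N ℚ) (i j : N)
    (K : Finset N) (hj : j ∉ K) : apminor M i j K = 0 ↔ ZCond M i j K := by
  unfold apminor
  rw [← Matrix.exists_mulVec_eq_zero_iff]
  constructor
  · rintro ⟨v, hv, hMv⟩
    let x : N → ℚ := fun a => if h : a ∈ K then v (Sum.inr ⟨a, h⟩) else
      if a = j then v (Sum.inl ()) else 0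
    have hxj : x j = v (Sum.inl ()) := by simp [x, hj]
    have hxk : ∀ k : K, x k = v (Sum.inr k) := fun k => by simp [x]
    have hx0 : ∀ a, a ∉ K → a ≠ j → x a = 0 := fun a h1 h2 => by simp [x, h1, h2]
    have key : ∀ s : Unit ⊕ K, (M *ᵥ x) (Sum.elim (fun _ => i) (fun k => (k : N)) s) = 0 := by
      intro s
      have h := congrFun hMv s
      simp only [Matrix.mulVec, dotProduct, Fintype.sum_sum_type, Matrix.of_apply,
        Pi.zero_apply] at h ⊢
      rw [sum_supp K j hj _ (fun a h1 h2 => by rw [hx0 a h1 h2, mul_zero]), hxj]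
      simp only [hxk]
      rw [Finset.univ_unique (α := Unit), Finset.sum_singleton] at h
      exact h
    refine ⟨x, ?_, hx0, ?_⟩
    · intro h0
      apply hv
      ext s
      rcases s with u | k
      · rw [Pi.zero_apply, ← hxj, h0]; rfl
      · rw [Pi.zero_apply, ← hxk, h0]; rfl
    · rintro a (ha | rfl)
      · exact key (Sum.inr ⟨a, ha⟩)
      · exact key (Sum.inl ())
  · rintro ⟨x, hx, hx0, hM⟩
    refine ⟨fun s => x (Sum.elim (fun _ => j) (fun k => (k : N)) s), ?_, ?_⟩
    · intro h0
      apply hx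
      ext a
      by_cases ha : a ∈ K
      · exact congrFun h0 (Sum.inr ⟨a, ha⟩)
      · by_cases haj : a = j
        · subst haj; exact congrFun h0 (Sum.inl ())
        · exact hx0 a ha haj
    · ext s
      have h : (M *ᵥ x) (Sum.elim (fun _ => i) (fun k => (k : N)) s) = 0 := by
        rcases s with u | k
        · exact hM _ (Or.inr rfl)
        · exact hM _ (Or.inl k.2)
      simp only [Matrix.mulVec, dotProduct, Fintype.sum_sum_type, Matrix.of_apply,
        Pi.zero_apply] at h ⊢
      rw [sum_supp K j hj _ (fun a h1 h2 => by rw [hx0 a h1 h2, mul_zero])] at h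
      rw [Finset.univ_unique (α := Unit), Finset.sum_singleton]
      exact h

lemma apminor_symm {N : Type*} [DecidableEq N] (M : Matrix N N ℚ) (hM : M.IsSymm) (i j : N)
    (K : Finset N) : apminor M i j K = apminor M j i K := by
  unfold apminor
  rw [← Matrix.det_transpose]
  congr 1
  ext a b
  simp only [Matrix.transpose_apply, Matrix.of_apply]
  exact hM.apply _ _

lemma mem_CIS {N : Type*} [DecidableEq N] (M : Matrix N N ℚ) (hM : M.IsSymm) (i j : N)
    (K : Finset N) :
    ((s(i, j), K) : CIStmt N) ∈ CIS M ↔ i ≠ j ∧ i ∉ K ∧ j ∉ K ∧ apminor M i j K = 0 := by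
  simp only [CIS, CIStmt.proper, Set.mem_ofPred_eq, Sym2.mk_isDiag_iff, Sym2.mem_iff]
  constructor
  · rintro ⟨⟨h1, h2⟩, h3⟩
    exact ⟨h1, h2 i (Or.inl rfl), h2 j (Or.inr rfl), h3 i j rfl⟩
  · rintro ⟨h1, h2, h3, h4⟩
    refine ⟨⟨h1, ?_⟩, ?_⟩
    · rintro a (rfl | rfl) <;> assumption
    · intro a b hab
      rcases Sym2.eq_iff.1 hab with ⟨rfl, rfl⟩ | ⟨rfl, rfl⟩
      · exact h4
      · rw [apminor_symm M hM]; exact h4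

def PM {N : Type*} [DecidableEq N] (Z : Finset N) (M : Matrix N N ℚ) : Matrix N N ℚ :=
  Matrix.of fun a b => if a ∈ Z then M a b else (1 : Matrix N N ℚ) a b

def QM {N : Type*} [DecidableEq N] (Z : Finset N) (M : Matrix N N ℚ) : Matrix N N ℚ :=
  Matrix.of fun a b => if a ∈ Z then -(1 : Matrix N N ℚ) a b else M a b

lemma PM_mulVec {N : Type*} [Fintype N] [DecidableEq N] (Z : Finset N) (M : Matrix N N ℚ)
    (x : N → ℚ) (a : N) : (PM Z M *ᵥ x) a = if a ∈ Z then (M *ᵥ x) a else x a := by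
  by_cases h : a ∈ Z
  · simp [PM, Matrix.mulVec, dotProduct, h]
  · simp [PM, Matrix.mulVec, dotProduct, h, Matrix.one_apply]

lemma QM_mulVec {N : Type*} [Fintype N] [DecidableEq N] (Z : Finset N) (M : Matrix N N ℚ)
    (x : N → ℚ) (a : N) : (QM Z M *ᵥ x) a = if a ∈ Z then -x a else (M *ᵥ x) a := by
  by_cases h : a ∈ Z
  · simp [QM, Matrix.mulVec, dotProduct, h, Matrix.one_apply]
  · simp [QM, Matrix.mulVec, dotProduct, h]

lemma PQ_symm {N : Type*} [Fintype N] [DecidableEq N] (Z : Finset N) (M : Matrix N N ℚ)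
    (hM : M.IsSymm) : (PM Z M)ᵀ * QM Z M = (QM Z M)ᵀ * PM Z M := by
  have h : ∀ b c, ((PM Z M)ᵀ * QM Z M) b c =
      M b c * (1 - (if b ∈ Z then 1 else 0) - (if c ∈ Z then 1 else 0)) := by
    intro b c
    have h1 : ∀ a, (PM Z M)ᵀ b a * QM Z M a c =
        (if a = c then (if c ∈ Z then -M c b else 0) else 0) +
        (if a = b then (if b ∈ Z then 0 else M b c) else 0) := by
      intro a
      simp only [PM, QM, Matrix.transpose_apply, Matrix.of_apply, Matrix.one_apply]
      split_ifs <;> simp_all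
    rw [Matrix.mul_apply, Finset.sum_congr rfl (fun a _ => h1 a), Finset.sum_add_distrib]
    simp only [Finset.sum_ite_eq', Finset.mem_univ, if_true]
    rw [hM.apply b c]
    split_ifs <;> ring
  have h2 : (QM Z M)ᵀ * PM Z M = ((PM Z M)ᵀ * QM Z M)ᵀ := by
    rw [Matrix.transpose_mul, Matrix.transpose_transpose]
  rw [h2]
  ext b c
  rw [Matrix.transpose_apply, h, h, hM.apply]
  ring

noncomputable def SM {N : Type*} [Fintype N] [DecidableEq N] (Z : Finset N) (M : Matrix N N ℚ) :
    Matrix N N ℚ := QM Z M * (PM Z M)⁻¹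

lemma SM_symm {N : Type*} [Fintype N] [DecidableEq N] (Z : Finset N) (M : Matrix N N ℚ)
    (hM : M.IsSymm) (hP : (PM Z M).det ≠ 0) : (SM Z M).IsSymm := by
  have hu : IsUnit (PM Z M).det := isUnit_iff_ne_zero.2 hP
  have hu' : IsUnit ((PM Z M)ᵀ).det := by rwa [Matrix.det_transpose]
  unfold Matrix.IsSymm SM
  rw [Matrix.transpose_mul, Matrix.transpose_nonsing_inv]
  have h := PQ_symm Z M hM
  calc ((PM Z M)ᵀ)⁻¹ * (QM Z M)ᵀ
      = ((PM Z M)ᵀ)⁻¹ * ((QM Z M)ᵀ * PM Z M) * (PM Z M)⁻¹ := by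
        rw [Matrix.mul_assoc, Matrix.mul_assoc, Matrix.mul_nonsing_inv _ hu, Matrix.mul_one]
    _ = ((PM Z M)ᵀ)⁻¹ * ((PM Z M)ᵀ * QM Z M) * (PM Z M)⁻¹ := by rw [h]
    _ = _ := by rw [← Matrix.mul_assoc, Matrix.nonsing_inv_mul _ hu', Matrix.one_mul]

lemma SM_cond {N : Type*} [Fintype N] [DecidableEq N] (Z : Finset N) (M : Matrix N N ℚ)
    (hP : (PM Z M).det ≠ 0) (i j : N) (K : Finset N) (hij : i ≠ j) (hi : i ∉ K) (hj : j ∉ K) :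
    ZCond (SM Z M) i j ((Z \ {i, j}) ∆ K) ↔ ZCond M i j K := by
  have hu : IsUnit (PM Z M).det := isUnit_iff_ne_zero.2 hP
  have hS : ∀ x, SM Z M *ᵥ (PM Z M *ᵥ x) = QM Z M *ᵥ x := by
    intro x
    rw [Matrix.mulVec_mulVec, SM, Matrix.mul_assoc, Matrix.nonsing_inv_mul _ hu, Matrix.mul_one]
  have hsurj : ∀ y, PM Z M *ᵥ ((PM Z M)⁻¹ *ᵥ y) = y := by
    intro y
    rw [Matrix.mulVec_mulVec, Matrix.mul_nonsing_inv _ hu, Matrix.one_mulVec]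
  have hinj : ∀ x, (PM Z M)⁻¹ *ᵥ (PM Z M *ᵥ x) = x := by
    intro y
    rw [Matrix.mulVec_mulVec, Matrix.nonsing_inv_mul _ hu, Matrix.one_mulVec]
  have hpt : ∀ x : N → ℚ,
      ((∀ a, a ∉ (Z \ {i, j}) ∆ K → a ≠ j → (PM Z M *ᵥ x) a = 0) ∧
        ∀ a, (a ∈ (Z \ {i, j}) ∆ K ∨ a = i) → (QM Z M *ᵥ x) a = 0) ↔
      ((∀ a, a ∉ K → a ≠ j → x a = 0) ∧ ∀ a, (a ∈ K ∨ a = i) → (M *ᵥ x) a = 0) := by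
    intro x
    rw [← forall_and, ← forall_and]
    apply forall_congr'
    intro a
    rw [PM_mulVec, QM_mulVec]
    simp only [Finset.mem_symmDiff, Finset.mem_sdiff, Finset.mem_insert, Finset.mem_singleton]
    by_cases h1 : a = i
    · subst h1
      by_cases h2 : a ∈ Z <;> simp [h2, hi, hij, and_comm]
    · by_cases h3 : a = j
      · subst h3
        simp [hj, h1]
      · by_cases h2 : a ∈ Z <;> by_cases h4 : a ∈ K <;> simp [h1, h2, h3, h4]
  constructor
  · rintro ⟨y, hy, h⟩
    refine ⟨(PM Z M)⁻¹ *ᵥ y, ?_, ?_⟩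
    · intro h0
      apply hy
      rw [← hsurj y, h0, Matrix.mulVec_zero]
    · rw [← hpt, ← hS, hsurj]
      exact h
  · rintro ⟨x, hx, h⟩
    refine ⟨PM Z M *ᵥ x, ?_, ?_⟩
    · intro h0
      apply hx
      rw [← hinj x, h0, Matrix.mulVec_zero]
    · rw [hS]
      exact (hpt x).2 h

lemma apminor_perm {N : Type*} [DecidableEq N] (M : Matrix N N ℚ) (π : Equiv.Perm N) (i j : N)
    (K : Finset N) : apminor (M.submatrix π.symm π.symm) (π i) (π j) (K.image π) =
      apminor M i j K := by
  unfold apminor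
  let e0 : K ≃ (K.image π : Finset N) := π.subtypeEquiv (fun a => by simp)
  let e : Unit ⊕ K ≃ Unit ⊕ (K.image π : Finset N) := Equiv.sumCongr (Equiv.refl _) e0
  rw [← Matrix.det_submatrix_equiv_self e]
  congr 1
  ext a b
  rcases a with a | a <;> rcases b with b | b <;>
    exact congrArg₂ M (π.symm_apply_apply _) (π.symm_apply_apply _)

lemma PM_diag {N : Type*} [Fintype N] [DecidableEq N] (Z : Finset N) :
    PM Z (Matrix.diagonal fun a => if a ∈ Z then (-1 : ℚ) else 1) =
      Matrix.diagonal fun a => if a ∈ Z then (-1 : ℚ) else 1 := by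
  ext a b
  by_cases h : a ∈ Z <;> simp [PM, h, Matrix.diagonal_apply, Matrix.one_apply]

lemma QM_diag {N : Type*} [Fintype N] [DecidableEq N] (Z : Finset N) :
    QM Z (Matrix.diagonal fun a => if a ∈ Z then (-1 : ℚ) else 1) =
      Matrix.diagonal fun a => if a ∈ Z then (-1 : ℚ) else 1 := by
  ext a b
  by_cases h' : a = b
  · subst h'
    by_cases h : a ∈ Z <;> simp [QM, h]
  · by_cases h : a ∈ Z <;> simp [QM, h, h']

lemma diag_det {N : Type*} [Fintype N] [DecidableEq N] (Z : Finset N) :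
    (Matrix.diagonal fun a => if a ∈ Z then (-1 : ℚ) else 1).det ≠ 0 := by
  rw [Matrix.det_diagonal, Finset.prod_ne_zero_iff]
  intro a _
  split_ifs <;> norm_num

lemma cont_PM {N : Type*} [Fintype N] [DecidableEq N] (Z : Finset N) :
    Continuous (PM Z) := by
  apply continuous_matrix
  intro a b
  by_cases h : a ∈ Z
  · simpa [PM, h] using continuous_id.matrix_elem a b
  · simpa [PM, h] using continuous_const

lemma cont_QM {N : Type*} [Fintype N] [DecidableEq N] (Z : Finset N) :
    Continuous (QM Z) := by
  apply continuous_matrix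
  intro a b
  by_cases h : a ∈ Z
  · simpa [QM, h] using continuous_const
  · simpa [QM, h] using continuous_id.matrix_elem a b

lemma tendsto_SM {N : Type*} [Fintype N] [DecidableEq N] (Z : Finset N) (π : Equiv.Perm N) :
    Tendsto (fun M => (SM Z M).submatrix π.symm π.symm)
      (𝓝 (Matrix.diagonal fun a => if a ∈ Z then (-1 : ℚ) else 1)) (𝓝 1) := by
  have hval : (SM Z (Matrix.diagonal fun a => if a ∈ Z then (-1 : ℚ) else 1)).submatrix
      π.symm π.symm = 1 := by
    rw [SM, PM_diag, QM_diag, Matrix.mul_nonsing_inv _ (isUnit_iff_ne_zero.2 (diag_det Z))]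
    exact Matrix.submatrix_one_equiv _
  rw [← hval]
  have hinv : ContinuousAt (fun M => (PM Z M)⁻¹)
      (Matrix.diagonal fun a => if a ∈ Z then (-1 : ℚ) else 1) := by
    simp only [Matrix.inv_def, Ring.inverse_eq_inv']
    refine ContinuousAt.smul (f := fun M => (PM Z M).det⁻¹)
      (g := fun M => (PM Z M).adjugate) ?_ ?_
    · apply ContinuousAt.inv₀
      · exact (cont_PM Z).matrix_det.continuousAt
      · rw [PM_diag]; exact diag_det Z
    · exact (cont_PM Z).matrix_adjugate.continuousAt
  have hS : ContinuousAt (SM Z) (Matrix.diagonal fun a => if a ∈ Z then (-1 : ℚ) else 1) := by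
    unfold SM
    exact (cont_QM Z).continuousAt.mul hinv
  have hsub : Continuous (fun M : Matrix N N ℚ => M.submatrix π.symm π.symm) :=
    continuous_id.matrix_submatrix _ _
  exact hsub.continuousAt.comp hS

lemma near_one {N : Type*} [Fintype N] [DecidableEq N] (ε : ℚ) (hε : 0 < ε) :
    ∀ᶠ M in 𝓝 (1 : Matrix N N ℚ), PosDefMinors M ∧
      ∀ a b : N, |M a b - (1 : Matrix N N ℚ) a b| < ε := by
  refine Filter.Eventually.and ?_ ?_
  · unfold PosDefMinors
    rw [Filter.eventually_all]
    intro S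
    have hc : Continuous (fun M : Matrix N N ℚ => pminor M S) :=
      (continuous_id.matrix_submatrix _ _).matrix_det
    have h1 : pminor (1 : Matrix N N ℚ) S = 1 := by
      unfold pminor
      rw [Matrix.submatrix_one _ Subtype.val_injective, Matrix.det_one]
    have := hc.tendsto (1 : Matrix N N ℚ)
    rw [h1] at this
    exact this.eventually (lt_mem_nhds one_pos)
  · rw [Filter.eventually_all]
    intro a
    rw [Filter.eventually_all]
    intro b
    have hc : Continuous (fun M : Matrix N N ℚ => |M a b - (1 : Matrix N N ℚ) a b|) :=
      ((continuous_id.matrix_elem a b).sub continuous_const).abs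
    have := hc.tendsto (1 : Matrix N N ℚ)
    simp only [sub_self, abs_zero] at this
    exact this.eventually (gt_mem_nhds hε)

lemma extract {N : Type*} [Fintype N] [DecidableEq N] (D : Matrix N N ℚ)
    (p : Matrix N N ℚ → Prop) (hp : ∀ᶠ M in 𝓝 D, p M) :
    ∃ ε : ℚ, 0 < ε ∧ ∀ M : Matrix N N ℚ, (∀ a b, |M a b - D a b| < ε) → p M := by
  obtain ⟨δ, hδ, h⟩ := (Metric.eventually_nhds_iff (α := N → N → ℚ) (x := D)).1 hp
  obtain ⟨ε, h0, h1⟩ := exists_rat_btwn hδ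
  refine ⟨ε, by exact_mod_cast h0, fun M hM => h ?_⟩
  refine (dist_pi_lt_iff hδ).2 fun a => (dist_pi_lt_iff hδ).2 fun b => ?_
  rw [Rat.dist_eq]
  refine lt_trans ?_ h1
  exact_mod_cast hM a b

/-- if a gaussoid is rationally realizable near every hyperoctahedral image
of the identity matrix (a ±1 diagonal matrix), then every hyperoctahedral image of it is
rationally realizable by positive-definite matrices arbitrarily close to the identity. -/
theorem stmt10 {N : Type*} [Fintype N] [DecidableEq N]
    (G : Set (CIStmt N)) (hG : IsGaussoid G)
    (hnear : ∀ J : N → ℚ, (∀ i, J i = 1 ∨ J i = -1) → ∀ ε : ℚ, 0 < ε →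
      ∃ Γ : Matrix N N ℚ, Γ.IsSymm ∧ PrinReg Γ ∧ CIS Γ = G ∧
        ∀ a b : N, |Γ a b - Matrix.diagonal J a b| < ε) :
    ∀ (Z : Finset N) (π : Equiv.Perm N) (H : Set (CIStmt N)),
      H = {t : CIStmt N | ∃ i j : N, ∃ K : Finset N,
            (s(i, j), K) ∈ G ∧ t = (s(π i, π j), ((Z \ {i, j}) ∆ K).image π)} →
      ∀ ε : ℚ, 0 < ε →
        ∃ Sig : Matrix N N ℚ, Sig.IsSymm ∧ PosDefMinors Sig ∧ CIS Sig = H ∧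
          ∀ a b : N, |Sig a b - (1 : Matrix N N ℚ) a b| < ε := by
  intro Z π H hH ε hε
  have hdet : ∀ᶠ M in 𝓝 (Matrix.diagonal fun a => if a ∈ Z then (-1 : ℚ) else 1),
      (PM Z M).det ≠ 0 := by
    have hc : Continuous (fun M : Matrix N N ℚ => (PM Z M).det) := (cont_PM Z).matrix_det
    apply hc.continuousAt.eventually_ne
    rw [PM_diag]
    exact diag_det Z
  obtain ⟨δ, hδ, hnr⟩ := extract _ _ (hdet.and ((tendsto_SM Z π).eventually (near_one ε hε)))
  obtain ⟨Γ, hsym, -, hCIS, hclose⟩ := hnear (fun a => if a ∈ Z then (-1 : ℚ) else 1)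
    (fun a => by by_cases h : a ∈ Z <;> simp [h]) δ hδ
  obtain ⟨hP, hpos, hε'⟩ := hnr Γ hclose
  have hS : (SM Z Γ).IsSymm := SM_symm Z Γ hsym hP
  have hS' : ((SM Z Γ).submatrix π.symm π.symm).IsSymm := hS.submatrix _
  refine ⟨_, hS', hpos, ?_, hε'⟩
  have main : ∀ i j K, i ≠ j → i ∉ K → j ∉ K →
      (apminor ((SM Z Γ).submatrix π.symm π.symm) (π i) (π j) (((Z \ {i, j}) ∆ K).image π) = 0 ↔
        apminor Γ i j K = 0) := by
    intro i j K hij hi hj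
    rw [apminor_perm, apminor_iff _ _ _ _ hj, apminor_iff, SM_cond Z Γ hP i j K hij hi hj]
    simp [Finset.mem_symmDiff, hj]
  rw [hH, ← hCIS]
  ext ⟨s, L⟩
  simp only [Set.mem_ofPred_eq]
  constructor
  · induction s using Sym2.ind with
    | _ a b =>
      intro h
      rw [mem_CIS _ hS'] at h
      obtain ⟨hab, ha, hb, h0⟩ := h
      have hij : π.symm a ≠ π.symm b := fun h => hab (π.symm.injective h)
      have hL : ((Z \ {π.symm a, π.symm b}) ∆
          ((Z \ {π.symm a, π.symm b}) ∆ (L.image π.symm))).image π = L := by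
        rw [symmDiff_symmDiff_cancel_left, Finset.image_image]
        simp
      have hi : π.symm a ∉ (Z \ {π.symm a, π.symm b}) ∆ (L.image π.symm) := by
        simp [Finset.mem_symmDiff, ha]
      have hj : π.symm b ∉ (Z \ {π.symm a, π.symm b}) ∆ (L.image π.symm) := by
        simp [Finset.mem_symmDiff, hb]
      refine ⟨π.symm a, π.symm b, (Z \ {π.symm a, π.symm b}) ∆ (L.image π.symm), ?_, ?_⟩
      · rw [mem_CIS _ hsym]
        refine ⟨hij, hi, hj, ?_⟩
        rw [← main _ _ _ hij hi hj, hL]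
        simpa using h0
      · rw [hL]
        simp
  · rintro ⟨i, j, K, hG', ht⟩
    rw [mem_CIS _ hsym] at hG'
    obtain ⟨hij, hi, hj, h0⟩ := hG'
    rw [ht, mem_CIS _ hS']
    refine ⟨fun h => hij (π.injective h), ?_, ?_, (main i j K hij hi hj).2 h0⟩
    · simp [Finset.mem_symmDiff, hi]
    · simp [Finset.mem_symmDiff, hj]
end

section
/- Let i, j, k be three distinct elements, M a nonempty finite set disjoint from {i,j,k}, and N = {i,j,k} ∪ M. Let G = {(ij|∅), (ik|M)} ⊆ A_N. Then G is a gaussoid, and for every diagonal matrix J indexed by N with all diagonal entries in {+1, −1} and every rational ε > 0, there exists a principally regular symmetric matrix Γ with rational entries, indexed by N, such that CIS(Γ) = G and |Γ_{ab} − J_{ab}| < ε for all a, b ∈ N. -/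
open scoped symmDiff

variable {N : Type*} [DecidableEq N]

open Filter Topology

def blk (A : Matrix N N ℚ) (K : Finset N) : Matrix K K ℚ :=
  A.submatrix (fun a : K => (a : N)) (fun a : K => (a : N))

noncomputable def sch (A : Matrix N N ℚ) (K : Finset N) (a b : N) : ℚ :=
  A a b - ∑ m : K, (∑ l : K, A a l * (blk A K)⁻¹ l m) * A m b

lemma apminor_eq_sch (A : Matrix N N ℚ) (K : Finset N) (a b : N) (h : pminor A K ≠ 0) :
    apminor A a b K = pminor A K * sch A K a b := by
  have hu : IsUnit (blk A K) := (Matrix.isUnit_iff_isUnit_det _).2 (isUnit_iff_ne_zero.2 h)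
  obtain ⟨inv⟩ := hu.nonempty_invertible
  have e : (Matrix.of fun x y : Unit ⊕ ↥K =>
      A (Sum.elim (fun _ => a) (fun k => (k : N)) x)
        (Sum.elim (fun _ => b) (fun k => (k : N)) y)) =
      Matrix.fromBlocks (Matrix.of fun _ _ : Unit => A a b) (Matrix.of fun (_ : Unit) (m : K) => A a m)
        (Matrix.of fun (m : K) (_ : Unit) => A m b) (blk A K) := by
    ext x y
    rcases x with x | x <;> rcases y with y | y <;> rfl
  unfold apminor
  rw [e, Matrix.det_fromBlocks₂₂, Matrix.invOf_eq_nonsing_inv]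
  congr 1
  rw [Matrix.det_unique]
  simp [Matrix.mul_apply, sch]

lemma apminor_insert (A : Matrix N N ℚ) (K : Finset N) (a b j : N) (hj : j ∉ K)
    (h : pminor A K ≠ 0) :
    apminor A a b (insert j K) =
      pminor A K * (sch A K a b * sch A K j j - sch A K a j * sch A K j b) := by
  have hu : IsUnit (blk A K) := (Matrix.isUnit_iff_isUnit_det _).2 (isUnit_iff_ne_zero.2 h)
  obtain ⟨inv⟩ := hu.nonempty_invertible
  let f : Fin 2 ⊕ K → Unit ⊕ ↥(insert j K) := Sum.elim
    (![Sum.inl (), Sum.inr ⟨j, Finset.mem_insert_self _ _⟩])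
    (fun x => Sum.inr ⟨x, Finset.mem_insert_of_mem x.2⟩)
  have hf : Function.Bijective f := by
    constructor
    · rintro (x | x) (y | y) hxy
      · fin_cases x <;> fin_cases y <;> simp_all [f]
      · fin_cases x
        · simp [f] at hxy
        · simp [f] at hxy
          exact absurd (hxy ▸ y.2) hj
      · fin_cases y
        · simp [f] at hxy
        · simp [f] at hxy
          exact absurd (hxy ▸ x.2) hj
      · simp [f] at hxy
        rw [hxy]
    · rintro (x | ⟨x, hx⟩)
      · exact ⟨Sum.inl 0, rfl⟩
      · rcases Finset.mem_insert.1 hx with rfl | hx'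
        · exact ⟨Sum.inl 1, rfl⟩
        · exact ⟨Sum.inr ⟨x, hx'⟩, rfl⟩
  have e : (Matrix.of fun x y : Unit ⊕ ↥(insert j K) =>
      A (Sum.elim (fun _ => a) (fun k => (k : N)) x)
        (Sum.elim (fun _ => b) (fun k => (k : N)) y)).submatrix
          (Equiv.ofBijective f hf) (Equiv.ofBijective f hf) =
      Matrix.fromBlocks (Matrix.of fun x y : Fin 2 => A (![a, j] x) (![b, j] y))
        (Matrix.of fun (x : Fin 2) (m : K) => A (![a, j] x) m)
        (Matrix.of fun (m : K) (y : Fin 2) => A m (![b, j] y)) (blk A K) := by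
    ext x y
    rcases x with x | x <;> rcases y with y | y
    · fin_cases x <;> fin_cases y <;> rfl
    · fin_cases x <;> rfl
    · fin_cases y <;> rfl
    · rfl
  unfold apminor
  rw [← Matrix.det_submatrix_equiv_self (Equiv.ofBijective f hf), e, Matrix.det_fromBlocks₂₂,
    Matrix.invOf_eq_nonsing_inv]
  congr 1
  rw [Matrix.det_fin_two]
  simp [Matrix.mul_apply, sch]

lemma apminor_symm_s13 (A : Matrix N N ℚ) (hA : A.IsSymm) (K : Finset N) (a b : N) :
    apminor A a b K = apminor A b a K := by
  unfold apminor
  rw [← Matrix.det_transpose]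
  congr 1
  ext x y
  exact hA.apply _ _

/-- the matrix with diagonal `J` and off-diagonal `t c`. -/
def gam (J : N → ℚ) (c : ℚ → N → N → ℚ) (t : ℚ) : Matrix N N ℚ :=
  Matrix.of fun a b => if a = b then J a else t * c t a b

noncomputable def qf (J : N → ℚ) (c : ℚ → N → N → ℚ) (K : Finset N) (a b : N) (t : ℚ) : ℚ :=
  ∑ m : K, (∑ l : K, c t a l * (blk (gam J c t) K)⁻¹ l m) * c t m b

lemma sch_gam (J : N → ℚ) (c : ℚ → N → N → ℚ) (K : Finset N) (a b : N) (t : ℚ)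
    (hab : a ≠ b) (ha : a ∉ K) (hb : b ∉ K) :
    sch (gam J c t) K a b = t * c t a b - t ^ 2 * qf J c K a b t := by
  unfold sch qf
  have h1 : ∀ l : K, gam J c t a l = t * c t a l := fun l => by
    have : a ≠ l := fun h => ha (h ▸ l.2)
    simp [gam, this]
  have h2 : ∀ l : K, gam J c t l b = t * c t l b := fun l => by
    have : (l : N) ≠ b := fun h => hb (h ▸ l.2)
    simp [gam, this]
  have h3 : gam J c t a b = t * c t a b := by simp [gam, hab]
  simp only [h1, h2, h3, Finset.mul_sum, Finset.sum_mul]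
  congr 1
  refine Finset.sum_congr rfl fun m _ => Finset.sum_congr rfl fun l _ => by ring

lemma blk_zero (J : N → ℚ) (c : ℚ → N → N → ℚ) (K : Finset N) :
    blk (gam J c 0) K = Matrix.diagonal (fun x : K => J x) := by
  ext x y
  by_cases h : x = y
  · subst h
    simp [blk, gam]
  · have h' : (x : N) ≠ y := fun e => h (Subtype.ext e)
    simp [blk, gam, h, h']

lemma cont_blk (J : N → ℚ) (c : ℚ → N → N → ℚ) (hc : ∀ a b, ContinuousAt (fun t => c t a b) 0)
    (K : Finset N) : ContinuousAt (fun t => blk (gam J c t) K) 0 := by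
  refine continuousAt_pi.2 fun x => continuousAt_pi.2 fun y => ?_
  by_cases h : (x : N) = y
  · simp only [blk, gam, Matrix.submatrix_apply, Matrix.of_apply, h, if_true]
    exact continuousAt_const
  · simp only [blk, gam, Matrix.submatrix_apply, Matrix.of_apply, h, if_false]
    exact continuousAt_id.mul (hc _ _)

lemma cont_det (J : N → ℚ) (c : ℚ → N → N → ℚ) (hc : ∀ a b, ContinuousAt (fun t => c t a b) 0)
    (K : Finset N) : ContinuousAt (fun t => pminor (gam J c t) K) 0 :=
  ContinuousAt.comp (f := fun t => blk (gam J c t) K) (g := fun A : Matrix K K ℚ => A.det)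
    (Continuous.matrix_det continuous_id).continuousAt (cont_blk J c hc K)

lemma det_zero_ne (J : N → ℚ) (hJ : ∀ a, J a = 1 ∨ J a = -1) (c : ℚ → N → N → ℚ) (K : Finset N) :
    pminor (gam J c 0) K ≠ 0 := by
  change (blk (gam J c 0) K).det ≠ 0
  rw [blk_zero, Matrix.det_diagonal]
  refine Finset.prod_ne_zero_iff.2 fun x _ => ?_
  rcases hJ x with h | h <;> simp [h]

lemma ev_det (J : N → ℚ) (hJ : ∀ a, J a = 1 ∨ J a = -1) (c : ℚ → N → N → ℚ)
    (hc : ∀ a b, ContinuousAt (fun t => c t a b) 0)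
    (K : Finset N) : ∀ᶠ t in 𝓝[≠] (0 : ℚ), pminor (gam J c t) K ≠ 0 :=
  ((cont_det J c hc K).eventually_ne (det_zero_ne J hJ c K)).filter_mono nhdsWithin_le_nhds

lemma cont_qf (J : N → ℚ) (hJ : ∀ a, J a = 1 ∨ J a = -1) (c : ℚ → N → N → ℚ)
    (hc : ∀ a b, ContinuousAt (fun t => c t a b) 0) (K : Finset N) (a b : N) :
    ContinuousAt (qf J c K a b) 0 := by
  have hinv : ∀ l m : K, ContinuousAt (fun t => (blk (gam J c t) K)⁻¹ l m) 0 := by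
    intro l m
    have h : (fun t => (blk (gam J c t) K)⁻¹ l m) =
        fun t => (pminor (gam J c t) K)⁻¹ * (blk (gam J c t) K).adjugate l m := by
      ext t
      rw [Matrix.inv_def, Ring.inverse_eq_inv]
      rfl
    rw [h]
    refine ((cont_det J c hc K).inv₀ (det_zero_ne J hJ c K)).mul ?_
    exact ContinuousAt.comp (f := fun t => blk (gam J c t) K)
      (g := fun A : Matrix K K ℚ => A.adjugate l m)
      ((Continuous.matrix_adjugate continuous_id).matrix_elem l m).continuousAt (cont_blk J c hc K)
  unfold qf
  refine tendsto_finsetSum _ fun m _ => ContinuousAt.mul ?_ (hc _ _)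
  exact tendsto_finsetSum _ fun l _ => (hc _ _).mul (hinv _ _)

lemma qf_zero (J : N → ℚ) (hJ : ∀ a, J a = 1 ∨ J a = -1) (c : ℚ → N → N → ℚ)
    (K : Finset N) (a b : N) :
    qf J c K a b 0 = ∑ l ∈ K, J l * c 0 a l * c 0 l b := by
  have h : (blk (gam J c 0) K)⁻¹ = Matrix.diagonal (fun x : K => J x) := by
    rw [blk_zero]
    apply Matrix.inv_eq_right_inv
    rw [Matrix.diagonal_mul_diagonal, ← Matrix.diagonal_one]
    congr 1
    ext x
    rcases hJ x with h | h <;> simp [h]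
  unfold qf
  rw [h, ← Finset.sum_coe_sort K]
  refine Finset.sum_congr rfl fun m _ => ?_
  have : ∑ l : K, c 0 a l * (Matrix.diagonal (fun x : K => J x)) l m = c 0 a m * J m := by
    simp [Matrix.diagonal_apply]
  rw [this]
  ring

lemma ev_one (J : N → ℚ) (hJ : ∀ a, J a = 1 ∨ J a = -1) (c : ℚ → N → N → ℚ)
    (hc : ∀ a b, ContinuousAt (fun t => c t a b) 0) (K : Finset N) (a b : N)
    (hab : a ≠ b) (ha : a ∉ K) (hb : b ∉ K) (h0 : c 0 a b ≠ 0) :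
    ∀ᶠ t in 𝓝[≠] (0 : ℚ), apminor (gam J c t) a b K ≠ 0 := by
  have h1 : ContinuousAt (fun t => c t a b - t * qf J c K a b t) 0 :=
    (hc a b).sub (continuousAt_id.mul (cont_qf J hJ c hc K a b))
  have h2 := (h1.eventually_ne (y := 0) (by simpa using h0)).filter_mono
    (nhdsWithin_le_nhds (s := {0}ᶜ))
  filter_upwards [h2, ev_det J hJ c hc K, self_mem_nhdsWithin] with t ht hd ht0
  rw [apminor_eq_sch _ _ _ _ hd, sch_gam J c K a b t hab ha hb]
  have : t * c t a b - t ^ 2 * qf J c K a b t = t * (c t a b - t * qf J c K a b t) := by ring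
  rw [this]
  exact mul_ne_zero hd (mul_ne_zero ht0 ht)

lemma ev_two (J : N → ℚ) (hJ : ∀ a, J a = 1 ∨ J a = -1) (c : ℚ → N → N → ℚ)
    (hc : ∀ a b, ContinuousAt (fun t => c t a b) 0) (K : Finset N) (a b : N)
    (hab : a ≠ b) (ha : a ∉ K) (hb : b ∉ K) (d : ℚ → ℚ) (hd : ContinuousAt d 0)
    (hcd : ∀ t, c t a b = t * d t)
    (h0 : d 0 ≠ ∑ l ∈ K, J l * c 0 a l * c 0 l b) :
    ∀ᶠ t in 𝓝[≠] (0 : ℚ), apminor (gam J c t) a b K ≠ 0 := by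
  have h1 : ContinuousAt (fun t => d t - qf J c K a b t) 0 :=
    hd.sub (cont_qf J hJ c hc K a b)
  have h2 := (h1.eventually_ne (y := 0) (by
    rw [qf_zero J hJ]; exact sub_ne_zero.2 h0)).filter_mono
    (nhdsWithin_le_nhds (s := {0}ᶜ))
  filter_upwards [h2, ev_det J hJ c hc K, self_mem_nhdsWithin] with t ht hd ht0
  rw [apminor_eq_sch _ _ _ _ hd, sch_gam J c K a b t hab ha hb, hcd]
  have : t * (t * d t) - t ^ 2 * qf J c K a b t = t * (t * (d t - qf J c K a b t)) := by ring
  rw [this]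
  exact mul_ne_zero hd (mul_ne_zero ht0 (mul_ne_zero ht0 ht))

def ebase (J : N → ℚ) (i j k : N) (a b : N) : ℚ :=
  if (a = i ∧ b = j) ∨ (a = j ∧ b = i) ∨ (a = i ∧ b = k) ∨ (a = k ∧ b = i) then 0
  else if a = i then J b else if b = i then J a else 1

noncomputable def yfun (J : N → ℚ) (i j k : N) (M : Finset N) (t : ℚ) : ℚ :=
  qf J (fun _ => ebase J i j k) M i k t

noncomputable def cfun (J : N → ℚ) (i j k : N) (M : Finset N) (t : ℚ) (a b : N) : ℚ :=
  if (a = i ∧ b = k) ∨ (a = k ∧ b = i) then t * yfun J i j k M t else ebase J i j k a b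

lemma cont_yfun (J : N → ℚ) (hJ : ∀ a, J a = 1 ∨ J a = -1) (i j k : N) (M : Finset N) :
    ContinuousAt (yfun J i j k M) 0 := by
  have h : yfun J i j k M = qf J (fun _ => ebase J i j k) M i k := by
    funext t
    rw [yfun]
  have hc : ∀ a b : N, ContinuousAt (fun t : ℚ => (fun _ : ℚ => ebase J i j k) t a b) 0 :=
    fun a b => continuousAt_const
  rw [h]
  exact cont_qf J hJ (fun _ => ebase J i j k) hc M i k

lemma gam_symm (J : N → ℚ) (i j k : N) (M : Finset N) (t : ℚ) :
    (gam J (cfun J i j k M) t).IsSymm := by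
  have he : ∀ a b, ebase J i j k a b = ebase J i j k b a := by
    intro a b
    unfold ebase
    by_cases h1 : a = i <;> by_cases h2 : b = i <;> simp [h1, h2]
  have hcs : ∀ a b, cfun J i j k M t a b = cfun J i j k M t b a := by
    intro a b
    unfold cfun
    rw [he a b]
    congr 1
    apply propext
    tauto
  ext a b
  simp only [Matrix.transpose_apply, gam, Matrix.of_apply]
  by_cases h : a = b
  · subst h; rfl
  · rw [if_neg h, if_neg (Ne.symm h), hcs]

lemma cfun_ne (J : N → ℚ) (i j k : N) (M : Finset N) (hJ0 : ∀ a, J a ≠ 0) (a b : N)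
    (h1 : s(a, b) ≠ s(i, j)) (h2 : s(a, b) ≠ s(i, k)) : cfun J i j k M 0 a b ≠ 0 := by
  simp only [ne_eq, Sym2.eq_iff] at h1 h2
  unfold cfun ebase
  rw [if_neg h2, if_neg (by tauto)]
  split_ifs
  · exact hJ0 b
  · exact hJ0 a
  · exact one_ne_zero

lemma gauss (i j k : N) (M : Finset N)
    (hij : i ≠ j) (hik : i ≠ k) (hjk : j ≠ k)
    (hM : M.Nonempty) (hiM : i ∉ M) (hjM : j ∉ M) (hkM : k ∉ M) :
    IsGaussoid ({(s(i, j), (∅ : Finset N)), (s(i, k), M)} : Set (CIStmt N)) := by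
  have hM0 := hM.ne_empty
  refine ⟨?_, ?_⟩
  · rintro s (rfl | rfl)
    · simp [CIStmt.proper, hij]
    · simp [CIStmt.proper, hik, hiM, hkM]
  · intro a b c L hab hac hbc ha hb hc
    have e1 : ∀ x : N, insert x L ≠ ∅ := fun x => Finset.insert_ne_empty _ _
    have e2 : ∀ x : N, insert x L = M → x ∈ M := fun x h => h ▸ Finset.mem_insert_self _ _
    have e3 : ∀ x : N, x ∉ L → insert x L = M → L ≠ M := fun x h h' h2 => h (h2 ▸ e2 x h')
    have e2b := e2 b
    have e2c := e2 c
    have e3b := e3 b hb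
    have e3c := e3 c hc
    have e1b := e1 b
    have e1c := e1 c
    simp only [Set.mem_insert_iff, Set.mem_singleton_iff, Prod.mk.injEq, Sym2.eq_iff]
    refine ⟨?_, ?_, ?_⟩ <;> grind

/-- the gaussoid `{(ij|∅), (ik|M)}` is rationally realizable near all
hyperoctahedral images of the identity matrix. -/
theorem stmt13 {N : Type*} [Fintype N] [DecidableEq N]
    (i j k : N) (M : Finset N)
    (hij : i ≠ j) (hik : i ≠ k) (hjk : j ≠ k)
    (hM : M.Nonempty) (hiM : i ∉ M) (hjM : j ∉ M) (hkM : k ∉ M)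
    (hN : ∀ x : N, x = i ∨ x = j ∨ x = k ∨ x ∈ M) :
    IsGaussoid ({(s(i, j), (∅ : Finset N)), (s(i, k), M)} : Set (CIStmt N)) ∧
    ∀ J : N → ℚ, (∀ a, J a = 1 ∨ J a = -1) → ∀ ε : ℚ, 0 < ε →
      ∃ Γ : Matrix N N ℚ, Γ.IsSymm ∧ PrinReg Γ ∧
        CIS Γ = ({(s(i, j), (∅ : Finset N)), (s(i, k), M)} : Set (CIStmt N)) ∧
        ∀ a b : N, |Γ a b - Matrix.diagonal J a b| < ε := by
  refine ⟨gauss i j k M hij hik hjk hM hiM hjM hkM, ?_⟩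
  intro J hJ ε hε
  have hJ2 : ∀ a, J a * J a = 1 := fun a => by rcases hJ a with h | h <;> simp [h]
  have hJ0 : ∀ a, J a ≠ 0 := fun a => by rcases hJ a with h | h <;> simp [h]
  set c := cfun J i j k M with hcdef
  set y := yfun J i j k M with hydef
  have hy : ContinuousAt y 0 := cont_yfun J hJ i j k M
  have hc : ∀ a b, ContinuousAt (fun t => c t a b) 0 := by
    intro a b
    by_cases h : (a = i ∧ b = k) ∨ (a = k ∧ b = i)
    · simp only [hcdef, cfun, h, if_true]
      exact continuousAt_id.mul hy
    · simp only [hcdef, cfun, h, if_false]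
      exact continuousAt_const
  have hsymm : ∀ t, (gam J c t).IsSymm := fun t => gam_symm J i j k M t
  have cij : ∀ t, c t i j = 0 := fun t => by simp [hcdef, cfun, ebase, hjk, hik]
  have cik : ∀ t, c t i k = t * y t := fun t => by simp [hcdef, hydef, cfun]
  have hmi : ∀ l ∈ M, l ≠ i := fun l hl h => hiM (h ▸ hl)
  have hmj : ∀ l ∈ M, l ≠ j := fun l hl h => hjM (h ▸ hl)
  have hmk : ∀ l ∈ M, l ≠ k := fun l hl h => hkM (h ▸ hl)
  have cil : ∀ t, ∀ l ∈ M, c t i l = J l := fun t l hl => by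
    simp [hcdef, cfun, ebase, hmi l hl, hmj l hl, hmk l hl, hij, hik]
  have clj : ∀ t, ∀ l ∈ M, c t l j = 1 := fun t l hl => by
    simp [hcdef, cfun, ebase, hmi l hl, hmj l hl, hmk l hl, hij.symm]
  have clk : ∀ t, ∀ l ∈ M, c t l k = 1 := fun t l hl => by
    simp [hcdef, cfun, ebase, hmi l hl, hmj l hl, hmk l hl, hik.symm]
  have ckj : ∀ t, c t k j = 1 := fun t => by
    simp [hcdef, cfun, ebase, hij.symm, hik.symm, hjk.symm]
  have cjk : ∀ t, c t j k = 1 := fun t => by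
    simp [hcdef, cfun, ebase, hij.symm, hik.symm, hjk]
  have cne : ∀ a b, a ≠ b → s(a, b) ≠ s(i, j) → s(a, b) ≠ s(i, k) → c 0 a b ≠ 0 :=
    fun a b _ h1 h2 => cfun_ne J i j k M hJ0 a b h1 h2
  -- y is the quadratic form of c
  have hyq : ∀ t, qf J c M i k t = y t := by
    intro t
    have hb : blk (gam J c t) M = blk (gam J (fun _ => ebase J i j k) t) M := by
      ext l m
      have h1 : (l : N) ≠ i := fun h => hiM (h ▸ l.2)
      have h2 : (l : N) ≠ k := fun h => hkM (h ▸ l.2)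
      simp [blk, gam, hcdef, cfun, h1, h2]
    rw [hydef]
    unfold yfun qf
    rw [hb]
    refine Finset.sum_congr rfl fun m _ => ?_
    have h1 : ∀ m : M, (m : N) ≠ i := fun m h => hiM (h ▸ m.2)
    have h2 : ∀ m : M, (m : N) ≠ k := fun m h => hkM (h ▸ m.2)
    simp [hcdef, cfun, h1, h2, hik]
  have hy0 : y 0 = (M.card : ℚ) := by
    rw [← hyq, qf_zero J hJ, Finset.sum_congr rfl (g := fun _ => (1 : ℚ))]
    · simp
    · intro l hl
      rw [cil 0 l hl, clk 0 l hl, hJ2, mul_one]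
  have hyne : ∀ᶠ t in 𝓝[≠] (0 : ℚ), y t ≠ 0 :=
    (hy.eventually_ne (by rw [hy0]; exact_mod_cast hM.card_pos.ne')).filter_mono
      nhdsWithin_le_nhds
  -- ij
  have Hij : ∀ K : Finset N, i ∉ K → j ∉ K → K ≠ ∅ →
      ∀ᶠ t in 𝓝[≠] (0 : ℚ), apminor (gam J c t) i j K ≠ 0 := by
    intro K hiK hjK hK
    by_cases hKM : (K.filter (· ∈ M)).Nonempty
    · refine ev_two J hJ c hc K i j hij hiK hjK (fun _ => 0) continuousAt_const
        (fun t => by simp [cij]) ?_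
      have : ∑ l ∈ K, J l * c 0 i l * c 0 l j = ∑ l ∈ K, if l ∈ M then (1 : ℚ) else 0 := by
        refine Finset.sum_congr rfl fun l hl => ?_
        by_cases hlM : l ∈ M
        · simp [cil 0 l hlM, clj 0 l hlM, hJ2, hlM]
        · have : l = k := by
            rcases hN l with rfl | rfl | rfl | h
            · exact absurd hl hiK
            · exact absurd hl hjK
            · rfl
            · exact absurd h hlM
          subst this
          simp [cik, hlM]
      rw [this, ← Finset.sum_filter]
      simp only [Finset.sum_const, nsmul_eq_mul, mul_one]
      exact_mod_cast hKM.card_pos.ne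
    · have hKk : K = insert k ∅ := by
        ext l
        have hsub : ∀ l ∈ K, l = k := by
          intro l hl
          rcases hN l with rfl | rfl | rfl | h
          · exact absurd hl hiK
          · exact absurd hl hjK
          · rfl
          · exact absurd ⟨l, Finset.mem_filter.2 ⟨hl, h⟩⟩ hKM
        constructor
        · intro hl; simp [hsub l hl]
        · intro hl
          obtain ⟨x, hx⟩ := Finset.nonempty_iff_ne_empty.2 hK
          have := hsub x hx
          simp at hl
          rw [hl, ← this]; exact hx
      filter_upwards [hyne, self_mem_nhdsWithin] with t ht ht0
      have hp : pminor (gam J c t) ∅ = 1 := by simp [pminor]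
      rw [hKk, apminor_insert _ _ _ _ _ (by simp) (by rw [hp]; exact one_ne_zero), hp]
      have ht0' : t ≠ 0 := ht0
      simp [sch, gam, hij, hik, hjk.symm, cij, cik, ckj, ht, ht0']
  have Hik : ∀ K : Finset N, i ∉ K → k ∉ K → K ≠ M →
      ∀ᶠ t in 𝓝[≠] (0 : ℚ), apminor (gam J c t) i k K ≠ 0 := by
    intro K hiK hkK hK
    by_cases hMK : M ⊆ K
    · have hKj : K = insert j M := by
        have hsub : ∀ l ∈ K, l ∉ M → l = j := by
          intro l hl hl'
          rcases hN l with rfl | rfl | rfl | h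
          · exact absurd hl hiK
          · rfl
          · exact absurd hl hkK
          · exact absurd h hl'
        have hjK : j ∈ K := by
          by_contra hjK
          refine hK (Finset.Subset.antisymm (fun l hl => ?_) hMK)
          by_contra hl'
          exact hjK (hsub l hl hl' ▸ hl)
        ext l
        simp only [Finset.mem_insert]
        constructor
        · intro hl
          by_cases h : l ∈ M
          · exact Or.inr h
          · exact Or.inl (hsub l hl h)
        · rintro (rfl | h)
          · exact hjK
          · exact hMK h
      have h1 := Hij M hiM hjM hM.ne_empty
      have h2 := ev_one J hJ c hc M j k hjk hjM hkM (by rw [cjk]; exact one_ne_zero)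
      filter_upwards [h1, h2, ev_det J hJ c hc M] with t h1 h2 hd
      rw [hKj, apminor_insert _ _ _ _ _ hjM hd]
      rw [apminor_eq_sch _ _ _ _ hd] at h1 h2
      have hs : sch (gam J c t) M i k = 0 := by
        rw [sch_gam J c M i k t hik hiM hkM, hyq, cik]; ring
      rw [hs, zero_mul, zero_sub]
      exact mul_ne_zero hd (neg_ne_zero.2 (mul_ne_zero (right_ne_zero_of_mul h1)
        (right_ne_zero_of_mul h2)))
    · refine ev_two J hJ c hc K i k hik hiK hkK y hy cik ?_
      have : ∑ l ∈ K, J l * c 0 i l * c 0 l k = ∑ l ∈ K, if l ∈ M then (1 : ℚ) else 0 := by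
        refine Finset.sum_congr rfl fun l hl => ?_
        by_cases hlM : l ∈ M
        · simp [cil 0 l hlM, clk 0 l hlM, hJ2, hlM]
        · have : l = j := by
            rcases hN l with rfl | rfl | rfl | h
            · exact absurd hl hiK
            · rfl
            · exact absurd hl hkK
            · exact absurd h hlM
          subst this
          simp [cij, hlM]
      rw [this, ← Finset.sum_filter, hy0]
      simp only [Finset.sum_const, nsmul_eq_mul, mul_one]
      have hlt : (K.filter (· ∈ M)).card < M.card := by
        apply Finset.card_lt_card
        refine ⟨fun x hx => (Finset.mem_filter.1 hx).2, fun h => hMK fun x hx => ?_⟩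
        exact (Finset.mem_filter.1 (h hx)).1
      exact_mod_cast hlt.ne'
  have Hall : ∀ᶠ t in 𝓝[≠] (0 : ℚ), ∀ (a b : N) (K : Finset N), a ≠ b → a ∉ K → b ∉ K →
      ¬ (s(a, b) = s(i, j) ∧ K = ∅) → ¬ (s(a, b) = s(i, k) ∧ K = M) →
      apminor (gam J c t) a b K ≠ 0 := by
    refine eventually_all.2 fun a => eventually_all.2 fun b => eventually_all.2 fun K => ?_
    by_cases h : a ≠ b ∧ a ∉ K ∧ b ∉ K ∧
      ¬ (s(a, b) = s(i, j) ∧ K = ∅) ∧ ¬ (s(a, b) = s(i, k) ∧ K = M)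
    · obtain ⟨hab, ha, hb, h1, h2⟩ := h
      have key : ∀ᶠ t in 𝓝[≠] (0 : ℚ), apminor (gam J c t) a b K ≠ 0 := by
        by_cases e1 : s(a, b) = s(i, j)
        · have hK : K ≠ ∅ := fun h => h1 ⟨e1, h⟩
          rcases Sym2.eq_iff.1 e1 with ⟨rfl, rfl⟩ | ⟨rfl, rfl⟩
          · exact Hij K ha hb hK
          · filter_upwards [Hij K hb ha hK] with t ht
            rwa [apminor_symm_s13 _ (hsymm t)]
        · by_cases e2 : s(a, b) = s(i, k)
          · have hK : K ≠ M := fun h => h2 ⟨e2, h⟩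
            rcases Sym2.eq_iff.1 e2 with ⟨rfl, rfl⟩ | ⟨rfl, rfl⟩
            · exact Hik K ha hb hK
            · filter_upwards [Hik K hb ha hK] with t ht
              rwa [apminor_symm_s13 _ (hsymm t)]
          · exact ev_one J hJ c hc K a b hab ha hb (cne a b hab e1 e2)
      filter_upwards [key] with t ht _ _ _ _ _ using ht
    · exact Eventually.of_forall fun t h1 h2 h3 h4 h5 => absurd ⟨h1, h2, h3, h4, h5⟩ h
  have Hdet : ∀ᶠ t in 𝓝[≠] (0 : ℚ), ∀ K, pminor (gam J c t) K ≠ 0 :=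
    eventually_all.2 fun K => ev_det J hJ c hc K
  have Hclose : ∀ᶠ t in 𝓝[≠] (0 : ℚ), ∀ a b : N,
      |gam J c t a b - Matrix.diagonal J a b| < ε := by
    refine eventually_all.2 fun a => eventually_all.2 fun b => ?_
    by_cases hab : a = b
    · subst hab
      simp [gam, hε]
    · have h1 : ContinuousAt (fun t => |t * c t a b|) 0 := (continuousAt_id.mul (hc a b)).abs
      have h2 := (h1.eventually_lt (continuousAt_const (y := ε)) (by simpa using hε)).filter_mono
        (nhdsWithin_le_nhds (s := {0}ᶜ))
      filter_upwards [h2] with t ht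
      simpa [gam, hab] using ht
  obtain ⟨t, ht1, ht2, ht3⟩ := (Hall.and (Hdet.and Hclose)).exists
  refine ⟨gam J c t, hsymm t, ht2, ?_, ht3⟩
  have z1 : apminor (gam J c t) i j ∅ = 0 := by
    rw [apminor_eq_sch _ _ _ _ (ht2 _), sch_gam J c ∅ i j t hij (by simp) (by simp), cij]
    simp [qf]
  have z2 : apminor (gam J c t) i k M = 0 := by
    rw [apminor_eq_sch _ _ _ _ (ht2 _), sch_gam J c M i k t hik hiM hkM, cik, hyq]
    ring
  ext ⟨p, K⟩
  induction p using Sym2.ind with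
  | _ a b =>
    simp only [Set.mem_insert_iff, Set.mem_singleton_iff, Prod.mk.injEq]
    constructor
    · rintro ⟨⟨hp1, hp2⟩, h⟩
      by_contra hcon
      refine ht1 a b K (by simpa using hp1) (hp2 a (by simp)) (hp2 b (by simp))
        (fun h => hcon (Or.inl h)) (fun h => hcon (Or.inr h)) (h a b rfl)
    · rintro (⟨h, rfl⟩ | ⟨h, rfl⟩)
      · rw [h]
        refine ⟨by simp [CIStmt.proper, hij], fun a b hab => ?_⟩
        rcases Sym2.eq_iff.1 hab with ⟨rfl, rfl⟩ | ⟨rfl, rfl⟩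
        · exact z1
        · rw [apminor_symm_s13 _ (hsymm t)]; exact z1
      · rw [h]
        refine ⟨by simp [CIStmt.proper, hik, hiM, hkM], fun a b hab => ?_⟩
        rcases Sym2.eq_iff.1 hab with ⟨rfl, rfl⟩ | ⟨rfl, rfl⟩
        · exact z2
        · rw [apminor_symm_s13 _ (hsymm t)]; exact z2
end

section
/- Let 𝕂 be any field and Γ a principally regular symmetric 5×5 matrix over 𝕂 with rows and columns indexed by {1,2,3,4,5}. Suppose the following nine almost-principal minors of Γ all vanish: det Γ_{12|∅}, det Γ_{13|{4}}, det Γ_{14|{5}}, det Γ_{23|{5}}, det Γ_{35|{1}}, det Γ_{45|{2}}, det Γ_{15|{2,3}}, det Γ_{34|{1,2}}, and det Γ_{24|{1,3,5}}. Then Γ_{15} = 0 or Γ_{24} = 0 or Γ_{25} = 0 or Γ_{34} = 0. -/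
open scoped symmDiff

variable {N : Type*} [DecidableEq N]

theorem apminor_eq_fin {R : Type*} [CommRing R] (M : Matrix (Fin 5) (Fin 5) R) (i j : Fin 5)
    (K : Finset (Fin 5)) {n : ℕ} (g : Fin n → Unit ⊕ ↥K) (hg : Function.Bijective g) :
    apminor M i j K = (Matrix.of fun a b : Fin n =>
      M (Sum.elim (fun _ => i) (fun k : ↥K => (k : Fin 5)) (g a))
        (Sum.elim (fun _ => j) (fun k : ↥K => (k : Fin 5)) (g b))).det := by
  unfold apminor
  rw [← Matrix.det_submatrix_equiv_self (Equiv.ofBijective g hg)]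
  congr 1
  ext a b
  simp only [Matrix.submatrix_apply, Matrix.of_apply, Equiv.ofBijective_apply]
  rcases g a with _ | _ <;> rcases g b with _ | _ <;> rfl

theorem pminor_eq_fin {R : Type*} [CommRing R] (M : Matrix (Fin 5) (Fin 5) R)
    (K : Finset (Fin 5)) {n : ℕ} (g : Fin n → ↥K) (hg : Function.Bijective g) :
    pminor M K = (Matrix.of fun a b : Fin n => M (g a) (g b)).det := by
  unfold pminor
  rw [← Matrix.det_submatrix_equiv_self (Equiv.ofBijective g hg)]
  rfl

theorem core {𝕂 : Type*} [Field 𝕂] (p1 p2 p3 p4 p5 a13 a14 a15 a23 a24 a25 a34 a35 a45 : 𝕂)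
    (q1 : p1 ≠ 0) (q2 : p2 ≠ 0) (q3 : p3 ≠ 0) (q4 : p4 ≠ 0) (q5 : p5 ≠ 0)
    (q15 : p1 * p5 - a15 * a15 ≠ 0)
    (h13 : a13 * p4 - a34 * a14 = 0) (h14 : a14 * p5 - a15 * a45 = 0)
    (h23 : a23 * p5 - a25 * a35 = 0) (h35 : a35 * p1 - a13 * a15 = 0)
    (h45 : a45 * p2 - a24 * a25 = 0)
    (h15 : a15 * (p2 * p3 - a23 * a23) + a13 * (a25 * a23 - p2 * a35) = 0)
    (h34 : a34 * p1 * p2 - a13 * a14 * p2 - a23 * a24 * p1 = 0)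
    (h24 : (!![a24, 0, a23, a25; a14, p1, a13, a15; a34, a13, p3, a35; a45, a15, a35, p5]).det = 0)
    (n15 : a15 ≠ 0) (n24 : a24 ≠ 0) (n25 : a25 ≠ 0) (n34 : a34 ≠ 0) : False := by
  have e24 : a24 * (p1 * p3 - a13 * a13) * (p1 * p5 - a15 * a15)
      - a23 * (p1 * a34 - a13 * a14) * (p1 * p5 - a15 * a15)
      - a25 * (p1 * p3 - a13 * a13) * (p1 * a45 - a15 * a14) = 0 := by
    simp [Matrix.det_succ_row_zero, Fin.sum_univ_succ, Fin.succAbove] at h24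
    linear_combination p1 * h24 + (a24 * (a35 * p1 - a13 * a15) - p1 * a23 * a45
      - p1 * a34 * a25 + a13 * a14 * a25 + a15 * a23 * a14) * h35
  obtain rfl : a45 = a24 * a25 / p2 := by field_simp; linear_combination h45
  obtain rfl : a14 = a15 * (a24 * a25 / p2) / p5 := by field_simp at h14 ⊢; linear_combination h14
  obtain rfl : a13 = a34 * (a15 * (a24 * a25 / p2) / p5) / p4 := by
    field_simp at h13 ⊢; linear_combination h13
  obtain rfl : a35 = a34 * (a15 * (a24 * a25 / p2) / p5) / p4 * a15 / p1 := by
    field_simp at h35 ⊢; linear_combination h35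
  obtain rfl : a23 = a25 * (a34 * (a15 * (a24 * a25 / p2) / p5) / p4 * a15 / p1) / p5 := by
    field_simp at h23 ⊢; linear_combination h23
  clear h24 h45 h14 h13 h35 h23
  field_simp at h34 h15 e24
  rw [mul_zero] at h34 h15 e24
  have A := (mul_eq_zero.mp h34).resolve_left n34
  have B := (mul_eq_zero.mp h15).resolve_left n15
  have q15' : p1 * p5 - a15 ^ 2 ≠ 0 := by rwa [sq]
  have E := (mul_eq_zero.mp e24).resolve_left (mul_ne_zero n24 q15')
  have two : (2 : 𝕂) ≠ 0 := by
    intro h2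
    have : p1 * p2 ^ 2 * p5 ^ 2 * p4 = 0 := by
      linear_combination A + a15 ^ 2 * a24 ^ 2 * a25 ^ 2 * h2
    simp_all
  have fin : 2 * (a15 ^ 2 * a24 ^ 2 * a25 ^ 2) * (p1 * p5 * a25 ^ 2 * p3 * p4) = 0 := by
    linear_combination B - E - (a34 ^ 2 * a15 ^ 2 * a25 ^ 2 + p1 * a25 ^ 2 * p5 * p4 * p3) * A
  simp_all

/-- a valid inference rule for algebraic Gaussians over every field.
The ground set {1,2,3,4,5} is modeled by `Fin 5` with `m : Fin 5` standing for `m+1`. -/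
theorem stmt16 (𝕂 : Type*) [Field 𝕂]
    (Γ : Matrix (Fin 5) (Fin 5) 𝕂) (hsym : Γ.IsSymm) (hpr : PrinReg Γ)
    (h12 : apminor Γ 0 1 (∅ : Finset (Fin 5)) = 0)
    (h13 : apminor Γ 0 2 ({3} : Finset (Fin 5)) = 0)
    (h14 : apminor Γ 0 3 ({4} : Finset (Fin 5)) = 0)
    (h23 : apminor Γ 1 2 ({4} : Finset (Fin 5)) = 0)
    (h35 : apminor Γ 2 4 ({0} : Finset (Fin 5)) = 0)
    (h45 : apminor Γ 3 4 ({1} : Finset (Fin 5)) = 0)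
    (h15 : apminor Γ 0 4 ({1, 2} : Finset (Fin 5)) = 0)
    (h34 : apminor Γ 2 3 ({0, 1} : Finset (Fin 5)) = 0)
    (h24 : apminor Γ 1 3 ({0, 2, 4} : Finset (Fin 5)) = 0) :
    Γ 0 4 = 0 ∨ Γ 1 3 = 0 ∨ Γ 1 4 = 0 ∨ Γ 2 3 = 0 := by
  have s : ∀ i j, Γ i j = Γ j i := fun i j => hsym.apply j i
  have q : ∀ i, Γ i i ≠ 0 := by
    intro i
    have h := hpr {i}
    rw [pminor_eq_fin Γ {i} ![⟨i, by simp⟩] (by clear h; revert i; decide)] at h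
    simpa using h
  have q15 := hpr {0, 4}
  rw [pminor_eq_fin Γ {0, 4} ![⟨0, by simp⟩, ⟨4, by simp⟩] (by decide)] at q15
  rw [apminor_eq_fin Γ _ _ _ ![Sum.inl ()] (by decide)] at h12
  rw [apminor_eq_fin Γ _ _ _ ![Sum.inl (), Sum.inr ⟨3, by simp⟩] (by decide)] at h13
  rw [apminor_eq_fin Γ _ _ _ ![Sum.inl (), Sum.inr ⟨4, by simp⟩] (by decide)] at h14 h23
  rw [apminor_eq_fin Γ _ _ _ ![Sum.inl (), Sum.inr ⟨0, by simp⟩] (by decide)] at h35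
  rw [apminor_eq_fin Γ _ _ _ ![Sum.inl (), Sum.inr ⟨1, by simp⟩] (by decide)] at h45
  rw [apminor_eq_fin Γ _ _ _ ![Sum.inl (), Sum.inr ⟨1, by simp⟩, Sum.inr ⟨2, by simp⟩] (by decide)] at h15
  rw [apminor_eq_fin Γ _ _ _ ![Sum.inl (), Sum.inr ⟨0, by simp⟩, Sum.inr ⟨1, by simp⟩] (by decide)] at h34
  rw [apminor_eq_fin Γ _ _ _ ![Sum.inl (), Sum.inr ⟨0, by simp⟩, Sum.inr ⟨2, by simp⟩, Sum.inr ⟨4, by simp⟩] (by decide)] at h24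
  simp [Matrix.det_fin_two, Matrix.det_fin_three] at q15 h12 h13 h14 h23 h35 h45 h15 h34
  by_contra! hn
  obtain ⟨n15, n24, n25, n34⟩ := hn
  simp only [s 1 0, s 2 0, s 3 0, s 4 0, s 2 1, s 3 1, s 4 1, s 3 2, s 4 2, s 4 3, h12] at q15 h13 h14 h23 h35 h45 h15 h34
  refine core (Γ 0 0) (Γ 1 1) (Γ 2 2) (Γ 3 3) (Γ 4 4) (Γ 0 2) (Γ 0 3) (Γ 0 4) (Γ 1 2) (Γ 1 3) (Γ 1 4)
    (Γ 2 3) (Γ 2 4) (Γ 3 4) (q 0) (q 1) (q 2) (q 3) (q 4) q15 ?_ ?_ ?_ ?_ ?_ ?_ ?_ ?_ n15 n24 n25 n34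
  · linear_combination h13
  · linear_combination h14
  · linear_combination h23
  · linear_combination h35
  · linear_combination h45
  · linear_combination h15
  · linear_combination h34
  · refine Eq.trans ?_ h24
    congr 1
    ext a b
    fin_cases a <;> fin_cases b <;> simp [s 1 0, s 2 0, s 3 0, s 4 0, s 2 1, s 3 1, s 4 1, s 3 2, s 4 2, s 4 3, h12]
end

section
/- Let N = {1,2,3,4} and G = {(13|{2,4}), (23|∅), (34|{1})} ⊆ A_N. Then: (a) there exists a symmetric positive-definite matrix Σ with rational entries indexed by N such that CIS(Σ) = G; but (b) there exists a real ε > 0 such that every symmetric positive-definite real matrix Σ indexed by N with CIS(Σ) = G satisfies |Σ_{ab} − I_{ab}| ≥ ε for some a, b ∈ N, where I is the identity matrix. In particular, G is positively realizable over ℚ but not realizable by positive-definite matrices arbitrarily close to the identity. -/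
open scoped symmDiff

variable {N : Type*} [DecidableEq N]

/-- The gaussoid `{(13|24), (23|∅), (34|1)}` on ground set {1,2,3,4}, modeled by `Fin 4`
with `m : Fin 4` standing for `m+1`. -/
def G20 : Set (CIStmt (Fin 4)) :=
  {(s((0 : Fin 4), 2), ({1, 3} : Finset (Fin 4))),
   (s((1 : Fin 4), 2), (∅ : Finset (Fin 4))),
   (s((2 : Fin 4), 3), ({0} : Finset (Fin 4)))}


/-- An explicit realization of `G20` with integer entries. -/
def witM : Matrix (Fin 4) (Fin 4) ℚ :=
  Matrix.of ![![2, 1, 1, 2], ![1, 2, 0, 2], ![1, 0, 2, 1], ![2, 2, 1, 3]]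

theorem witM_pos : ∀ S : Finset (Fin 4), 0 < pminor witM S := by
  unfold pminor
  decide +kernel

theorem witM_ap : ∀ i j : Fin 4, ∀ K : Finset (Fin 4), i ≠ j → i ∉ K → j ∉ K →
    (apminor witM i j K = 0 ↔
      ((s(i, j), K) : Sym2 (Fin 4) × Finset (Fin 4)) ∈
        ({(s((0 : Fin 4), 2), ({1, 3} : Finset (Fin 4))),
          (s((1 : Fin 4), 2), (∅ : Finset (Fin 4))),
          (s((2 : Fin 4), 3), ({0} : Finset (Fin 4)))} :
            Finset (Sym2 (Fin 4) × Finset (Fin 4)))) := by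
  unfold apminor
  decide +kernel

/-- Reindexing of an almost-principal minor along an enumeration of `K`. -/
theorem apminor_reindex {R : Type*} [CommRing R] (M : Matrix (Fin 4) (Fin 4) R) (i j : Fin 4)
    (K : Finset (Fin 4)) (n : ℕ) (e : Fin n ≃ Unit ⊕ ↥K) (f g : Fin n → Fin 4)
    (hf : ∀ a, Sum.elim (fun _ => i) (fun k : K => (k : Fin 4)) (e a) = f a)
    (hg : ∀ a, Sum.elim (fun _ => j) (fun k : K => (k : Fin 4)) (e a) = g a) :
    apminor M i j K = (Matrix.of fun a b => M (f a) (g b)).det := by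
  unfold apminor
  rw [← Matrix.det_submatrix_equiv_self e]
  congr 1
  ext a b
  simp only [Matrix.submatrix_apply, Matrix.of_apply, ← hf, ← hg]
  rcases e a with x | x <;> rcases e b with y | y <;> rfl

theorem apminor_zero {R : Type*} [CommRing R] (M : Matrix (Fin 4) (Fin 4) R) (i j : Fin 4) :
    apminor M i j ∅ = M i j := by
  rw [apminor_reindex M i j ∅ 1 (Equiv.ofBijective (fun _ => Sum.inl ()) (by decide +kernel))
    ![i] ![j] (by intro a; fin_cases a; rfl) (by intro a; fin_cases a; rfl)]
  simp

theorem apminor_one {R : Type*} [CommRing R] (M : Matrix (Fin 4) (Fin 4) R) :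
    apminor M 2 3 {0} = M 2 3 * M 0 0 - M 2 0 * M 0 3 := by
  let t : Fin 2 → Unit ⊕ ↥({0} : Finset (Fin 4)) := ![Sum.inl (), Sum.inr ⟨0, by decide⟩]
  have ht : Function.Bijective t := by decide +kernel
  rw [apminor_reindex M 2 3 {0} 2 (Equiv.ofBijective t ht) ![2, 0] ![3, 0]
    (by intro a; fin_cases a <;> rfl) (by intro a; fin_cases a <;> rfl)]
  rw [Matrix.det_fin_two]
  simp

theorem apminor_two {R : Type*} [CommRing R] (M : Matrix (Fin 4) (Fin 4) R) :
    apminor M 0 2 {1, 3} =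
      M 0 2 * (M 1 1 * M 3 3 - M 1 3 * M 3 1) - M 0 1 * (M 1 2 * M 3 3 - M 1 3 * M 3 2)
        + M 0 3 * (M 1 2 * M 3 1 - M 1 1 * M 3 2) := by
  let t : Fin 3 → Unit ⊕ ↥({1, 3} : Finset (Fin 4)) :=
    ![Sum.inl (), Sum.inr ⟨1, by decide⟩, Sum.inr ⟨3, by decide⟩]
  have ht : Function.Bijective t := by decide +kernel
  rw [apminor_reindex M 0 2 {1, 3} 3 (Equiv.ofBijective t ht) ![0, 1, 3] ![2, 1, 3]
    (by intro a; fin_cases a <;> rfl) (by intro a; fin_cases a <;> rfl)]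
  rw [Matrix.det_fin_three]
  simp
  ring

/-- `G20` is positively realizable over ℚ, but not by positive-definite
matrices arbitrarily close to the identity. -/
theorem stmt19 :
    (∃ Sig : Matrix (Fin 4) (Fin 4) ℚ,
      Sig.IsSymm ∧ PosDefMinors Sig ∧ CIS Sig = G20) ∧
    (∃ ε : ℝ, 0 < ε ∧
      ∀ Sig : Matrix (Fin 4) (Fin 4) ℝ,
        Sig.IsSymm → PosDefMinors Sig → CIS Sig = G20 →
        ∃ a b : Fin 4, ε ≤ |Sig a b - (1 : Matrix (Fin 4) (Fin 4) ℝ) a b|) := by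
  constructor
  · refine ⟨witM, ?_, witM_pos, ?_⟩
    · unfold Matrix.IsSymm
      decide +kernel
    · ext ⟨s, K⟩
      induction s using Sym2.ind with
      | _ i j =>
        have key := witM_ap i j K
        constructor
        · rintro ⟨⟨h1, h2⟩, h3⟩
          have hij : i ≠ j := by simpa using h1
          have hi : i ∉ K := h2 i (by simp)
          have hj : j ∉ K := h2 j (by simp)
          have := (key hij hi hj).1 (h3 i j rfl)
          simpa only [Finset.mem_insert, Finset.mem_singleton, G20, Set.mem_insert_iff,
            Set.mem_singleton_iff] using this
        · intro h
          have hp : ∀ s ∈ ({(s((0 : Fin 4), 2), ({1, 3} : Finset (Fin 4))),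
              (s((1 : Fin 4), 2), (∅ : Finset (Fin 4))),
              (s((2 : Fin 4), 3), ({0} : Finset (Fin 4)))} :
              Finset (Sym2 (Fin 4) × Finset (Fin 4))),
              ∀ i j : Fin 4, s.1 = s(i, j) → i ≠ j ∧ i ∉ s.2 ∧ j ∉ s.2 := by
            decide +kernel
          have h' : ((s(i, j), K) : Sym2 (Fin 4) × Finset (Fin 4)) ∈
              ({(s((0 : Fin 4), 2), ({1, 3} : Finset (Fin 4))),
                (s((1 : Fin 4), 2), (∅ : Finset (Fin 4))),
                (s((2 : Fin 4), 3), ({0} : Finset (Fin 4)))} :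
                  Finset (Sym2 (Fin 4) × Finset (Fin 4))) := by
            simpa only [Finset.mem_insert, Finset.mem_singleton, G20, Set.mem_insert_iff,
              Set.mem_singleton_iff] using h
          obtain ⟨hij, hi, hj⟩ := hp _ h' i j rfl
          refine ⟨⟨by simpa using hij, ?_⟩, ?_⟩
          · intro k hk
            rcases Sym2.mem_iff.1 hk with rfl | rfl
            · exact hi
            · exact hj
          · intro k l hkl
            obtain ⟨hkl', hk, hl⟩ := hp _ h' k l hkl
            refine (witM_ap k l K hkl' hk hl).2 ?_
            have e : s(i, j) = s(k, l) := hkl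
            rw [← e]
            exact h'
  · refine ⟨1 / 10, by norm_num, ?_⟩
    intro M hs _ hC
    by_contra! hlt
    have sy : ∀ i j, M i j = M j i := fun i j => hs.apply j i
    have h1 : apminor M 0 2 {1, 3} = 0 := by
      have : (s((0 : Fin 4), 2), ({1, 3} : Finset (Fin 4))) ∈ CIS M := by
        rw [hC]; simp [G20]
      exact this.2 0 2 rfl
    have h2 : apminor M 1 2 ∅ = 0 := by
      have : (s((1 : Fin 4), 2), (∅ : Finset (Fin 4))) ∈ CIS M := by
        rw [hC]; simp [G20]
      exact this.2 1 2 rfl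
    have h3 : apminor M 2 3 {0} = 0 := by
      have : (s((2 : Fin 4), 3), ({0} : Finset (Fin 4))) ∈ CIS M := by
        rw [hC]; simp [G20]
      exact this.2 2 3 rfl
    have hb : M 0 2 ≠ 0 := by
      intro hb
      have hm : (s((0 : Fin 4), 2), (∅ : Finset (Fin 4))) ∈ CIS M := by
        refine ⟨⟨by simp, by simp⟩, ?_⟩
        intro i j hij
        rw [apminor_zero]
        have hij' : s((0 : Fin 4), 2) = s(i, j) := hij
        rcases Sym2.eq_iff.1 hij' with ⟨rfl, rfl⟩ | ⟨rfl, rfl⟩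
        · exact hb
        · rw [sy]; exact hb
      rw [hC] at hm
      have hn : ((s((0 : Fin 4), 2), (∅ : Finset (Fin 4))) : Sym2 (Fin 4) × Finset (Fin 4)) ∉
          ({(s((0 : Fin 4), 2), ({1, 3} : Finset (Fin 4))),
            (s((1 : Fin 4), 2), (∅ : Finset (Fin 4))),
            (s((2 : Fin 4), 3), ({0} : Finset (Fin 4)))} :
              Finset (Sym2 (Fin 4) × Finset (Fin 4))) := by
        decide +kernel
      apply hn
      simpa only [Finset.mem_insert, Finset.mem_singleton, G20, Set.mem_insert_iff,
        Set.mem_singleton_iff] using hm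
    rw [apminor_two] at h1
    rw [apminor_zero] at h2
    rw [apminor_one] at h3
    rw [h2, sy 3 1, sy 3 2] at h1
    rw [sy 2 0] at h3
    have b0 := abs_lt.1 (hlt 0 0)
    have b1 := abs_lt.1 (hlt 1 1)
    have b3 := abs_lt.1 (hlt 3 3)
    have ba := hlt 0 1
    have bc := hlt 0 3
    have be := hlt 1 3
    simp only [Matrix.one_apply_eq] at b0 b1 b3
    rw [Matrix.one_apply_ne (by decide), sub_zero] at ba bc be
    generalize M 0 0 = p at *
    generalize M 1 1 = q at *
    generalize M 3 3 = s at *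
    generalize M 0 1 = a at *
    generalize M 0 3 = c at *
    generalize M 1 3 = e at *
    generalize M 0 2 = b at *
    generalize M 2 3 = f at *
    have key : b * (p * (q * s - e * e) + a * c * e - c * c * q) = 0 := by
      linear_combination p * h1 + (c * q - a * e) * h3
    have key2 := (mul_eq_zero.1 key).resolve_left hb
    have hqs : (81 : ℝ) / 100 ≤ q * s := by nlinarith
    have hee : e * e ≤ 1 / 100 := by
      have := abs_lt.1 be
      nlinarith
    have hcc : c * c ≤ 1 / 100 := by
      have := abs_lt.1 bc
      nlinarith
    have hace : |a * c * e| ≤ 1 / 10 * (1 / 10) * (1 / 10) := by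
      rw [abs_mul, abs_mul]
      gcongr
    have hace' := (abs_le.1 hace).1
    have hp : (9 : ℝ) / 10 * (80 / 100) ≤ p * (q * s - e * e) := by
      apply mul_le_mul <;> linarith
    have hcq : c * c * q ≤ 1 / 100 * (11 / 10) := by
      apply mul_le_mul <;> linarith
    linarith
end
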